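/- arXiv:1302.0073 — 5 statements merged into one kernel-verified Lean document; each statement's English description precedes it below -/
import Mathlib

section
/- For every integer k and every prime p with p ≠ 2 and p ≠ 5, the p-adic valuation of binom(kp−1, p−1) − 1 − k(k−1)·p·H({1}; p−1) is at least 5; that is, binom(kp−1, p−1) ≡ 1 + k(k−1)·p·H({1}; p−1) (mod p^5). -/
open Finset Polynomial

/-- The multiple harmonic sum `H({1}^j; m)`: the `j`-th elementary symmetric
polynomial evaluated at `1, 1/2, ..., 1/m`. -/
noncomputable def mhs (j m : ℕ) : ℚ :=
  ∑ s ∈ Finset.powersetCard j (Finset.Icc 1 m), ∏ i ∈ s, (1 : ℚ) / i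

/-- The polynomial `(X - 1)(X - 2)⋯(X - n)`. -/
noncomputable def prodXSub (n : ℕ) : ℤ[X] :=
  ∏ j ∈ range n, (X - C ((j : ℤ) + 1))

lemma prodXSub_succ (n : ℕ) : prodXSub (n + 1) = prodXSub n * (X - C ((n : ℤ) + 1)) :=
  prod_range_succ _ _

lemma mhs_one_succ (n : ℕ) : mhs 1 (n + 1) = mhs 1 n + 1 / ((n : ℚ) + 1) := by
  simp [mhs, powersetCard_one, sum_Icc_succ_top]

lemma prodXSub_coeff_zero (n : ℕ) :
    (prodXSub n).coeff 0 = (-1) ^ n * (n.factorial : ℤ) := by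
  induction n with
  | zero => simp [prodXSub]
  | succ n ih =>
    rw [prodXSub_succ, mul_coeff_zero, ih, Nat.factorial_succ]
    simp only [coeff_sub, coeff_X_zero, coeff_C_zero]
    push_cast
    ring

lemma prodXSub_coeff_one (n : ℕ) :
    ((prodXSub n).coeff 1 : ℚ) = -((-1) ^ n * n.factorial * mhs 1 n) := by
  induction n with
  | zero => simp [prodXSub, mhs, powersetCard_one, coeff_one]
  | succ n ih =>
    have h0 : ((prodXSub n).coeff 0 : ℚ) = (-1) ^ n * n.factorial := by
      rw [prodXSub_coeff_zero]; push_cast; rfl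
    have hn : (n : ℚ) + 1 ≠ 0 := by positivity
    rw [prodXSub_succ, mul_sub, coeff_sub, coeff_mul_C, coeff_mul_X, mhs_one_succ,
      Nat.factorial_succ]
    push_cast
    rw [ih, h0]
    field_simp
    ring

lemma prodXSub_eval (n : ℕ) (x : ℤ) :
    (((prodXSub n).eval x : ℤ) : ℚ) = n.factorial * Ring.choose ((x : ℚ) - 1) n := by
  rw [← nsmul_eq_mul, ← Ring.descPochhammer_eq_factorial_smul_choose]
  induction n with
  | zero => simp [prodXSub]
  | succ n ih =>
    rw [prodXSub_succ, descPochhammer_succ_right, smeval_mul, ← ih, eval_mul, smeval_sub,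
      smeval_X, smeval_natCast]
    simp
    left
    ring

/-- The symmetry of `(X - 1)⋯(X - (p - 1))` under `X ↦ p - X`, for odd `p`. -/
lemma prodXSub_comp {p : ℕ} (hp : Odd p) :
    (prodXSub (p - 1)).comp (C (p : ℤ) - X) = prodXSub (p - 1) := by
  have hev : Even (p - 1) := Nat.Odd.sub_odd hp odd_one
  rw [prodXSub, Polynomial.prod_comp, ← prod_range_reflect]
  have : ∀ j ∈ range (p - 1),
      (X - C (((p - 1 - 1 - j : ℕ) : ℤ) + 1)).comp (C (p : ℤ) - X) =
        (-1) * (X - C ((j : ℤ) + 1)) := by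
    intro j hj
    have hj := mem_range.mp hj
    have e : ((p - 1 - 1 - j : ℕ) : ℤ) + 1 = p - (j + 1) := by omega
    rw [e]
    simp only [sub_comp, X_comp, C_comp, C_sub]
    ring
  rw [prod_congr rfl this, prod_mul_distrib, prod_const, card_range, hev.neg_one_pow, one_mul]

/-- A polynomial symmetric under `X ↦ a - X` splits off a constant and a multiple of
`X (X - a)` with symmetric cofactor. -/
lemma exists_eq_C_add_mul_of_comp_eq {a : ℤ} (ha : a ≠ 0) {f : ℤ[X]}
    (hf : f.comp (C a - X) = f) :
    ∃ (c : ℤ) (g : ℤ[X]), g.comp (C a - X) = g ∧ f = C c + X * (X - C a) * g := by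
  obtain ⟨q, hq⟩ := X_dvd_sub_C (p := f)
  have h0 : f.eval a = f.eval 0 := by
    conv_lhs => rw [← hf]
    simp [eval_comp]
  have hqa : q.IsRoot a := by
    have h1 := congrArg (eval a) hq
    simp only [eval_sub, eval_C, eval_mul, eval_X, h0, coeff_zero_eq_eval_zero, sub_self] at h1
    exact (mul_eq_zero.mp h1.symm).resolve_left ha
  obtain ⟨g, rfl⟩ := dvd_iff_isRoot.mpr hqa
  have hfg : f = C (f.coeff 0) + X * (X - C a) * g := by linear_combination hq
  refine ⟨f.coeff 0, g, ?_, hfg⟩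
  have h2 := congrArg (fun q => q.comp (C a - X)) hfg
  simp only [add_comp, mul_comp, sub_comp, X_comp, C_comp, hf] at h2
  have h3 : X * (X - C a) * g.comp (C a - X) = X * (X - C a) * g := by
    linear_combination hfg - h2
  exact mul_left_cancel₀ (mul_ne_zero X_ne_zero (X_sub_C_ne_zero a)) h3

lemma prod_range_X_sub_C_zmod (p : ℕ) [hp : Fact p.Prime] :
    ∏ j ∈ range p, (X - C (j : ZMod p)) = X ^ p - X := by
  have hmonic : (X ^ p - X : (ZMod p)[X]).Monic :=
    monic_X_pow_sub (by simpa using hp.out.one_lt)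
  have hroots : (X ^ p - X : (ZMod p)[X]).roots = univ.val := by
    simpa [ZMod.card] using FiniteField.roots_X_pow_card_sub_X (ZMod p)
  have h := prod_multiset_X_sub_C_of_monic_of_roots_card_eq hmonic (by
    rw [hroots, FiniteField.X_pow_card_sub_X_natDegree_eq _ hp.out.one_lt]
    simp [ZMod.card])
  rw [hroots] at h
  rw [← h]
  change _ = ∏ a : ZMod p, (X - C a)
  refine prod_nbij' (fun j => (j : ZMod p)) ZMod.val ?_ ?_ ?_ ?_ ?_
  · simp
  · simp [ZMod.val_lt]
  · intro j hj
    exact ZMod.val_cast_of_lt (mem_range.mp hj)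
  · simp
  · simp

lemma prodXSub_map_zmod (p : ℕ) [hp : Fact p.Prime] :
    (prodXSub (p - 1)).map (Int.castRingHom (ZMod p)) = X ^ (p - 1) - 1 := by
  have h := prod_range_X_sub_C_zmod p
  obtain ⟨m, rfl⟩ : ∃ m, p = m + 1 := ⟨p - 1, by have := hp.out.pos; omega⟩
  rw [prod_range_succ'] at h
  refine mul_right_cancel₀ (X_ne_zero (R := ZMod (m + 1))) ?_
  simp only [prodXSub, Polynomial.map_prod, Nat.add_sub_cancel]
  simp only [Nat.cast_zero, C_0, sub_zero] at h
  rw [sub_mul, ← pow_succ, one_mul, ← h]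
  simp

/-- An integral form of the congruence, obtained by clearing the denominator `(p - 1)!`. -/
lemma pow_five_dvd_prodXSub (k : ℤ) {p : ℕ} (hp : p.Prime) (hp2 : p ≠ 2) (hp5 : p ≠ 5) :
    (p : ℤ) ^ 5 ∣ (prodXSub (p - 1)).eval (k * p) - (prodXSub (p - 1)).coeff 0 +
      k * (k - 1) * p * (prodXSub (p - 1)).coeff 1 := by
  have hfact : Fact p.Prime := ⟨hp⟩
  have hp0 : (p : ℤ) ≠ 0 := by exact_mod_cast hp.ne_zero
  obtain ⟨c, f, hf, hcf⟩ :=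
    exists_eq_C_add_mul_of_comp_eq hp0 (prodXSub_comp (hp.odd_of_ne_two hp2))
  obtain ⟨a, g, hg, rfl⟩ := exists_eq_C_add_mul_of_comp_eq hp0 hf
  obtain ⟨b, r, -, rfl⟩ := exists_eq_C_add_mul_of_comp_eq hp0 hg
  have hc0 : (prodXSub (p - 1)).coeff 0 = c := by
    rw [hcf]
    simp [-eq_intCast]
  have hc1 : (prodXSub (p - 1)).coeff 1 = -(p * a) := by
    have : prodXSub (p - 1) = C c + X * (C (-(p * a)) + X * (C a + (X - C (p : ℤ)) ^ 2 *
        (C b + X * (X - C (p : ℤ)) * r))) := by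
      rw [hcf]
      simp only [C_neg, C_mul]
      ring
    rw [this, coeff_add, coeff_X_mul]
    simp [coeff_C, -eq_intCast]
  have hb : (p : ℤ) ∣ b := by
    have h := prodXSub_map_zmod p
    rw [hcf] at h
    have h' : C (c : ZMod p) + C (a : ZMod p) * X ^ 2 + C (b : ZMod p) * X ^ 4 +
        r.map (Int.castRingHom (ZMod p)) * X ^ 6 = X ^ (p - 1) - 1 := by
      rw [← h]
      simp
      ring
    have h4 := congrArg (fun q => coeff q 4) h'
    have hne : 4 ≠ p - 1 := by omega
    simp [coeff_C, coeff_X_pow, coeff_one, coeff_mul_X_pow', hne, -map_intCast, -eq_intCast] at h4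
    exact (ZMod.intCast_zmod_eq_zero_iff_dvd b p).mp h4
  obtain ⟨d, rfl⟩ := hb
  rw [hc0, hc1, hcf]
  simp only [eval_add, eval_mul, eval_C, eval_X, eval_sub]
  refine ⟨d * (k * (k - 1)) ^ 2 + p * (k * (k - 1)) ^ 3 * r.eval (k * p), ?_⟩
  ring

theorem stmt14 (k : ℤ) (p : ℕ) (hp : p.Prime) (hp2 : p ≠ 2) (hp5 : p ≠ 5) :
    padicNorm p (Ring.choose ((k : ℚ) * p - 1) (p - 1) -
        1 - (k : ℚ) * ((k : ℚ) - 1) * (p : ℚ) * mhs 1 (p - 1))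
      ≤ (p : ℚ) ^ (-(5 : ℤ)) := by
  have hfact : Fact p.Prime := ⟨hp⟩
  have hev : Even (p - 1) := Nat.Odd.sub_odd (hp.odd_of_ne_two hp2) odd_one
  have hdvd := pow_five_dvd_prodXSub k hp hp2 hp5
  have hunit : padicNorm p ((p - 1).factorial : ℚ) = 1 := by
    rw [padicNorm.nat_eq_one_iff, hp.dvd_factorial]
    have := hp.pos
    omega
  rw [← Nat.cast_pow] at hdvd
  have hle := padicNorm.dvd_iff_norm_le.mp hdvd
  refine le_of_eq_of_le ?_ hle
  refine (one_mul _).symm.trans ?_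
  refine (congrArg (· * _) hunit.symm).trans ?_
  rw [← padicNorm.mul]
  congr 1
  push_cast
  rw [prodXSub_eval, prodXSub_coeff_one, prodXSub_coeff_zero, hev.neg_one_pow, hev.neg_one_pow]
  push_cast
  ring
end

section
/- For every odd prime p, the p-adic valuation of binom(2p−1, p−1) − (1 + 14·p·H({1}; p−1) − 12·p²·H({1}²; p−1) + 8·p³·H({1}³; p−1)) is at least 9; that is, binom(2p−1, p−1) ≡ 1 + 14 p H({1}; p−1) − 12 p² H({1}²; p−1) + 8 p³ H({1}³; p−1) (mod p^9). -/
open Finset Polynomial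

theorem coeff_prod_one_add_C_mul_X {R ι : Type*} [CommRing R] (s : Finset ι) (a : ι → R) (j : ℕ) :
    (∏ i ∈ s, (1 + C (a i) * X)).coeff j = ∑ t ∈ s.powersetCard j, ∏ i ∈ t, a i := by
  simp_rw [Finset.prod_one_add, Finset.prod_mul_distrib, Finset.prod_const, ← map_prod,
    finsetSum_coeff, coeff_C_mul_X_pow, Finset.powersetCard_eq_filter, Finset.sum_filter,
    eq_comm (a := j)]

/-- The rising factorial polynomial `(X + 1) ⋯ (X + m)`. -/
noncomputable def risingPoly (m : ℕ) : ℤ[X] :=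
  ∏ i ∈ Finset.range m, (X + C ((i : ℤ) + 1))

/-- The polynomial `∏ (Y + i (2h + 1 - i))` over `1 ≤ i ≤ h`, which turns into
`risingPoly (2 * h)` under `Y = X ^ 2 + (2h + 1) X`. -/
noncomputable def foldedPoly (h : ℕ) : ℤ[X] :=
  ∏ i ∈ Finset.range h, (X + C (((i : ℤ) + 1) * (2 * h - i)))

theorem risingPoly_coeff (m j : ℕ) :
    ((risingPoly m).coeff j : ℚ) = (m.factorial : ℚ) * mhs j m := by
  have hmap : (risingPoly m).map (Int.castRingHom ℚ) =
      C (m.factorial : ℚ) * ∏ i ∈ Finset.Icc 1 m, (1 + C ((1 : ℚ) / i) * X) := by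
    rw [show Finset.Icc 1 m = Finset.Ico 1 (m + 1) from rfl, Finset.prod_Ico_eq_prod_range,
      Nat.add_sub_cancel, ← Finset.prod_range_add_one_eq_factorial, Nat.cast_prod, map_prod,
      ← Finset.prod_mul_distrib, risingPoly, Polynomial.map_prod]
    refine Finset.prod_congr rfl fun i _ => ?_
    have hi0 : ((1 + i : ℕ) : ℚ) ≠ 0 := by positivity
    rw [mul_add, ← mul_assoc, ← C_mul, add_comm i 1, mul_one_div_cancel hi0]
    simp [add_comm]
  rw [mhs, ← coeff_prod_one_add_C_mul_X, ← coeff_C_mul, ← hmap, coeff_map, eq_intCast]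

theorem risingPoly_eq_comp (h : ℕ) :
    risingPoly (2 * h) = (foldedPoly h).comp (X ^ 2 + C (2 * h + 1 : ℤ) * X) := by
  rw [risingPoly, foldedPoly, two_mul, Finset.prod_range_add,
    ← Finset.prod_range_reflect (fun i => X + C (((h + i : ℕ) : ℤ) + 1)),
    ← Finset.prod_mul_distrib, Polynomial.prod_comp]
  refine Finset.prod_congr rfl fun i hi => ?_
  have hcast : ((h + (h - 1 - i) : ℕ) : ℤ) = 2 * h - 1 - i := by
    have := Finset.mem_range.mp hi
    omega
  rw [hcast]
  simp
  ring

theorem risingPoly_map_zmod (p : ℕ) [Fact p.Prime] :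
    (risingPoly (p - 1)).map (Int.castRingHom (ZMod p)) = X ^ (p - 1) - 1 := by
  have hp := (Fact.out : p.Prime).two_le
  have hprod : (risingPoly (p - 1)).map (Int.castRingHom (ZMod p)) =
      ∏ i ∈ Finset.range (p - 1), (X - C (-((i + 1 : ℕ) : ZMod p))) := by
    rw [risingPoly, Polynomial.map_prod]
    refine Finset.prod_congr rfl fun i _ => ?_
    simp
    ring
  have hne (i : ℕ) (hi : i ∈ Finset.range (p - 1)) : ((i + 1 : ℕ) : ZMod p) ≠ 0 := by
    rw [Ne, ZMod.natCast_eq_zero_iff]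
    intro hdvd
    have := Nat.le_of_dvd (by omega) hdvd
    have := Finset.mem_range.mp hi
    omega
  have hdeg : (X ^ (p - 1) - 1 : (ZMod p)[X]).degree = (p - 1 : ℕ) :=
    degree_X_pow_sub_C (by omega) 1
  have hmon : (X ^ (p - 1) - 1 : (ZMod p)[X]).Monic :=
    monic_X_pow_sub_C 1 (by omega)
  rw [hprod]
  refine eq_of_degree_le_of_eval_index_eq (Finset.range (p - 1))
    (v := fun i : ℕ => -((i + 1 : ℕ) : ZMod p)) ?_ ?_ ?_ ?_ ?_
  · intro i hi j hj hij
    have hij' := (ZMod.natCast_eq_natCast_iff' _ _ _).mp (neg_injective hij)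
    have := Finset.mem_range.mp hi
    have := Finset.mem_range.mp hj
    rw [Nat.mod_eq_of_lt (by omega), Nat.mod_eq_of_lt (by omega)] at hij'
    omega
  · simp only [degree_prod, degree_X_sub_C]
    simp
  · rw [hdeg]
    simp only [degree_prod, degree_X_sub_C]
    simp
  · rw [hmon.leadingCoeff, (monic_prod_of_monic _ _ fun i _ => monic_X_sub_C _).leadingCoeff]
  · intro i hi
    rw [eval_prod, Finset.prod_eq_zero hi (by simp)]
    simp only [eval_sub, eval_pow, eval_X, eval_one]
    rw [ZMod.pow_card_sub_one_eq_one (neg_ne_zero.mpr (hne i hi)), sub_self]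

theorem dvd_foldedPoly_coeff_four (h : ℕ) (hp : (2 * h + 1).Prime) :
    ((2 * h + 1 : ℕ) : ℤ) ∣ (foldedPoly h).coeff 4 := by
  have := Fact.mk hp
  have hh : h ≠ 4 := by
    rintro rfl
    revert hp
    norm_num
  have hzero : ((2 * h + 1 : ℕ) : ZMod (2 * h + 1)) = 0 := ZMod.natCast_self _
  have hmap := congrArg (Polynomial.map (Int.castRingHom (ZMod (2 * h + 1)))) (risingPoly_eq_comp h)
  have hrise := risingPoly_map_zmod (2 * h + 1)
  rw [Nat.add_sub_cancel] at hrise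
  have hlin : (X ^ 2 + C (2 * h + 1 : ℤ) * X : ℤ[X]).map (Int.castRingHom (ZMod (2 * h + 1))) =
      X ^ 2 := by
    have hC : Int.castRingHom (ZMod (2 * h + 1)) (2 * h + 1 : ℤ) = 0 := by
      exact_mod_cast hzero
    rw [Polynomial.map_add, Polynomial.map_mul, map_C, hC]
    simp
  rw [hrise, Polynomial.map_comp, hlin, ← expand_eq_comp_X_pow] at hmap
  have hcoeff := congrArg (fun f => f.coeff (4 * 2)) hmap
  simp only [coeff_expand_mul (by norm_num : 0 < 2), coeff_sub, coeff_X_pow, coeff_one,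
    coeff_map] at hcoeff
  rw [if_neg (by omega), if_neg (by omega), sub_zero] at hcoeff
  exact (ZMod.intCast_zmod_eq_zero_iff_dvd _ _).mp hcoeff.symm

theorem exists_eq_X_pow_four_mul_add (G : ℤ[X]) :
    ∃ R : ℤ[X], R.coeff 0 = G.coeff 4 ∧
      G = X ^ 4 * R + C (G.coeff 3) * X ^ 3 + C (G.coeff 2) * X ^ 2 + C (G.coeff 1) * X +
        C (G.coeff 0) := by
  refine ⟨G.divX.divX.divX.divX, by simp [coeff_divX], ?_⟩
  have h0 := divX_mul_X_add G
  have h1 := divX_mul_X_add G.divX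
  have h2 := divX_mul_X_add G.divX.divX
  have h3 := divX_mul_X_add G.divX.divX.divX
  simp only [coeff_divX, zero_add, Nat.reduceAdd] at h1 h2 h3
  linear_combination -h0 - X * h1 - X ^ 2 * h2 - X ^ 3 * h3

/-- For `F(X) = G(X ^ 2 + p X)`, the value `F(p)` agrees with a combination of the first four
coefficients of `F` up to `16 p ^ 8 G₄ + O(p ^ 10)`. -/
theorem exists_eval_comp_eq (G : ℤ[X]) (p : ℤ) :
    ∃ c : ℤ, (G.comp (X ^ 2 + C p * X)).eval p =
      (G.comp (X ^ 2 + C p * X)).coeff 0 + 14 * p * (G.comp (X ^ 2 + C p * X)).coeff 1 -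
        12 * p ^ 2 * (G.comp (X ^ 2 + C p * X)).coeff 2 +
        8 * p ^ 3 * (G.comp (X ^ 2 + C p * X)).coeff 3 + 16 * p ^ 8 * (G.coeff 4 + p * c) := by
  obtain ⟨R, hR0, hR⟩ := exists_eq_X_pow_four_mul_add G
  obtain ⟨c, hc⟩ : p ∣ R.eval (2 * p ^ 2) - R.eval 0 :=
    dvd_trans ⟨2 * p, by ring⟩ (sub_dvd_eval_sub (2 * p ^ 2) 0 R)
  rw [← coeff_zero_eq_eval_zero, hR0] at hc
  refine ⟨c, ?_⟩
  set g0 := G.coeff 0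
  set g1 := G.coeff 1
  set g2 := G.coeff 2
  set g3 := G.coeff 3
  have hcomp : G.comp (X ^ 2 + C p * X) =
      X ^ 4 * ((X + C p) ^ 4 * R.comp (X ^ 2 + C p * X) + C g3 * (X ^ 2 + C (3 * p) * X +
        C (3 * p ^ 2)) + C g2) + C (g3 * p ^ 3 + 2 * g2 * p) * X ^ 3 +
        C (g2 * p ^ 2 + g1) * X ^ 2 + C (g1 * p) * X + C g0 := by
    conv_lhs => rw [hR]
    simp
    ring
  have heval : (G.comp (X ^ 2 + C p * X)).eval p = (2 * p ^ 2) ^ 4 * R.eval (2 * p ^ 2) +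
      g3 * (2 * p ^ 2) ^ 3 + g2 * (2 * p ^ 2) ^ 2 + g1 * (2 * p ^ 2) + g0 := by
    have hval : (X ^ 2 + C p * X : ℤ[X]).eval p = 2 * p ^ 2 := by
      simp
      ring
    rw [eval_comp, hval]
    conv_lhs => rw [hR]
    simp
  have hcoeff (j : ℕ) (hj : j < 4) : (G.comp (X ^ 2 + C p * X)).coeff j =
      (C (g3 * p ^ 3 + 2 * g2 * p) * X ^ 3 +
        C (g2 * p ^ 2 + g1) * X ^ 2 + C (g1 * p) * X + C g0 : ℤ[X]).coeff j := by
    rw [hcomp]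
    simp only [coeff_add, coeff_X_pow_mul', if_neg (not_le.mpr hj), zero_add]
  rw [heval, hcoeff 0 (by norm_num), hcoeff 1 (by norm_num), hcoeff 2 (by norm_num),
    hcoeff 3 (by norm_num)]
  simp only [coeff_add, coeff_C_mul, coeff_X_pow, coeff_X, coeff_C]
  norm_num
  linear_combination 16 * p ^ 8 * hc

theorem risingPoly_eval_natCast (m n : ℕ) :
    (risingPoly m).eval (n : ℤ) = m.factorial * (n + m).choose m := by
  rw [risingPoly, eval_prod]
  have := Nat.ascFactorial_eq_factorial_mul_choose n m
  rw [Nat.ascFactorial_eq_prod_range] at this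
  rw [← Nat.cast_mul, ← this, Nat.cast_prod]
  refine Finset.prod_congr rfl fun i _ => ?_
  simp
  ring

theorem stmt15 (p : ℕ) (hp : p.Prime) (hodd : Odd p) :
    padicNorm p (((2 * p - 1).choose (p - 1) : ℚ) -
        (1 + 14 * (p : ℚ) * mhs 1 (p - 1) - 12 * (p : ℚ) ^ 2 * mhs 2 (p - 1) +
          8 * (p : ℚ) ^ 3 * mhs 3 (p - 1)))
      ≤ (p : ℚ) ^ (-(9 : ℤ)) := by
  have := Fact.mk hp
  obtain ⟨h, hph⟩ := hodd
  obtain ⟨d, hd⟩ : (p : ℤ) ∣ (foldedPoly h).coeff 4 := by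
    subst hph
    exact dvd_foldedPoly_coeff_four h hp
  obtain ⟨c, hc⟩ := exists_eval_comp_eq (foldedPoly h) p
  have hcast : (p : ℤ) = 2 * h + 1 := by exact_mod_cast hph
  have hcomp : (foldedPoly h).comp (X ^ 2 + C (p : ℤ) * X) = risingPoly (p - 1) := by
    rw [hcast, ← risingPoly_eq_comp, hph, Nat.add_sub_cancel]
  rw [hcomp, risingPoly_eval_natCast, hd, show p + (p - 1) = 2 * p - 1 by omega] at hc
  have hcQ := congrArg (Int.cast : ℤ → ℚ) hc
  push_cast at hcQ
  simp only [risingPoly_coeff] at hcQ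
  have hmhs : mhs 0 (p - 1) = 1 := by simp [mhs]
  rw [hmhs] at hcQ
  have hnorm : padicNorm p ((p - 1).factorial : ℚ) = 1 := by
    rw [padicNorm.nat_eq_one_iff, hp.dvd_factorial]
    have := hp.pos
    omega
  have hscale (x : ℚ) : padicNorm p ((p - 1).factorial * x) = padicNorm p x := by
    rw [padicNorm.mul, hnorm, one_mul]
  rw [← hscale]
  have hdvd := (padicNorm.dvd_iff_norm_le (p := p) (n := 9)).mp
    (show ((p ^ 9 : ℕ) : ℤ) ∣ p ^ 9 * (16 * (d + c)) by simp)
  refine le_trans (le_of_eq (congrArg (padicNorm p) ?_)) hdvd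
  push_cast
  linear_combination hcQ
end

section
/- Let n ≥ 0 and 0 ≤ j ≤ 2n be integers. Then there exists a unique polynomial b ∈ ℚ[T] of degree at most 2n such that (T−1)^{n+1} divides b − (T−1)^j and T^{n+1} divides b − (−T)^j; moreover this polynomial b has integer coefficients. -/
open Polynomial

theorem isCoprime_X_sub_one_pow_X_pow {R : Type*} [CommRing R] (m : ℕ) :
    IsCoprime ((X - 1 : R[X]) ^ m) (X ^ m) :=
  IsCoprime.pow ⟨-1, 1, by ring⟩

theorem monic_X_sub_one_pow_mul_X_pow {R : Type*} [CommRing R] (m : ℕ) :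
    ((X - 1 : R[X]) ^ m * X ^ m).Monic := by
  have h : (X - 1 : R[X]).Monic := by simpa using monic_X_sub_C (1 : R)
  exact (h.pow m).mul (monic_X_pow m)

theorem natDegree_X_sub_one_pow_mul_X_pow {R : Type*} [CommRing R] [IsDomain R] (m : ℕ) :
    ((X - 1 : R[X]) ^ m * X ^ m).natDegree = 2 * m := by
  have h : (X - 1 : R[X]).Monic := by simpa using monic_X_sub_C (1 : R)
  have hd : (X - 1 : R[X]).natDegree = 1 := by simpa using natDegree_X_sub_C (1 : R)
  rw [(h.pow m).natDegree_mul (monic_X_pow m), natDegree_pow, natDegree_X_pow, hd]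
  ring

/-- A polynomial of degree less than `2 * m` is determined by its residues modulo
`(X - 1) ^ m` and `X ^ m`. -/
theorem eq_of_dvd_sub_of_natDegree_lt {R : Type*} [CommRing R] [IsDomain R] {m : ℕ}
    {p q f g : R[X]} (hp : p.natDegree < 2 * m) (hq : q.natDegree < 2 * m)
    (hpf : (X - 1) ^ m ∣ p - f) (hpg : X ^ m ∣ p - g)
    (hqf : (X - 1) ^ m ∣ q - f) (hqg : X ^ m ∣ q - g) : p = q := by
  have h₁ : (X - 1) ^ m ∣ p - q := by simpa using dvd_sub hpf hqf
  have h₂ : X ^ m ∣ p - q := by simpa using dvd_sub hpg hqg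
  refine sub_eq_zero.mp (eq_zero_of_dvd_of_natDegree_lt
    ((isCoprime_X_sub_one_pow_X_pow m).mul_dvd h₁ h₂) ?_)
  rw [natDegree_X_sub_one_pow_mul_X_pow]
  exact (natDegree_sub_le p q).trans_lt (max_lt hp hq)

theorem exists_natDegree_lt_dvd_sub {R : Type*} [CommRing R] [IsDomain R] {m : ℕ} (hm : m ≠ 0)
    (f g : R[X]) :
    ∃ p : R[X], p.natDegree < 2 * m ∧ (X - 1) ^ m ∣ p - f ∧ X ^ m ∣ p - g := by
  obtain ⟨u, v, huv⟩ := isCoprime_X_sub_one_pow_X_pow (R := R) m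
  set M : R[X] := (X - 1) ^ m * X ^ m
  have hdeg : M.natDegree = 2 * m := natDegree_X_sub_one_pow_mul_X_pow m
  set p₀ : R[X] := u * (X - 1) ^ m * g + v * X ^ m * f
  have hdiv : p₀ %ₘ M = p₀ - M * (p₀ /ₘ M) :=
    eq_sub_of_add_eq (modByMonic_add_div p₀ M)
  refine ⟨p₀ %ₘ M, ?_, ⟨u * (g - f) - X ^ m * (p₀ /ₘ M), ?_⟩,
    ⟨v * (f - g) - (X - 1) ^ m * (p₀ /ₘ M), ?_⟩⟩
  · rw [← hdeg]
    refine natDegree_modByMonic_lt _ (monic_X_sub_one_pow_mul_X_pow m) fun h => ?_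
    rw [h, natDegree_one] at hdeg
    omega
  · rw [hdiv]
    linear_combination f * huv
  · rw [hdiv]
    linear_combination g * huv

/-- A polynomial invariant under `X ↦ 1 - X` has even degree. -/
theorem even_natDegree_of_comp_one_sub_X {R : Type*} [CommRing R] [IsDomain R] [CharZero R]
    {p : R[X]} (h : p.comp (1 - X) = p) : Even p.natDegree := by
  by_contra hodd
  rw [Nat.not_even_iff_odd] at hodd
  have hX : (1 - X : R[X]) = -(X - C 1) := by simp
  have hlc := congrArg leadingCoeff h
  rw [leadingCoeff_comp (by rw [hX, natDegree_neg, natDegree_X_sub_C]; exact one_ne_zero), hX,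
    leadingCoeff_neg, leadingCoeff_X_sub_C, hodd.neg_one_pow, mul_neg_one,
    neg_eq_self, leadingCoeff_eq_zero] at hlc
  simp [hlc] at hodd

theorem exists_int_natDegree_le_dvd_sub (n j : ℕ) :
    ∃ p : ℤ[X], p.natDegree ≤ 2 * n ∧ (X - 1) ^ (n + 1) ∣ p - (X - 1) ^ j ∧
      X ^ (n + 1) ∣ p - (-X) ^ j := by
  obtain ⟨p, hp, h₁, h₂⟩ :=
    exists_natDegree_lt_dvd_sub (Nat.succ_ne_zero n) ((X - 1 : ℤ[X]) ^ j) ((-X) ^ j)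
  refine ⟨p, ?_, h₁, h₂⟩
  have hX : (1 - X : ℤ[X]) = -(X - 1) := by ring
  have hcomp : p.comp (1 - X) = p := by
    refine eq_of_dvd_sub_of_natDegree_lt (m := n + 1) ?_ hp ?_ ?_ h₁ h₂
    · have hd : (1 - X : ℤ[X]).natDegree = 1 := by
        rw [hX, natDegree_neg]
        simpa using natDegree_X_sub_C (1 : ℤ)
      rwa [natDegree_comp, hd, mul_one]
    · obtain ⟨c, hc⟩ := h₂
      have := congrArg (fun q : ℤ[X] => q.comp (1 - X)) hc
      simp only [sub_comp, mul_comp, pow_comp, neg_comp, X_comp] at this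
      rw [neg_sub] at this
      rw [this, hX, neg_pow, mul_comm ((-1) ^ (n + 1)), mul_assoc]
      exact dvd_mul_right _ _
    · obtain ⟨c, hc⟩ := h₁
      have := congrArg (fun q : ℤ[X] => q.comp (1 - X)) hc
      simp only [sub_comp, mul_comp, pow_comp, one_comp, X_comp] at this
      rw [show (1 - X - 1 : ℤ[X]) = -X by ring] at this
      rw [this, neg_pow (X : ℤ[X]) (n + 1), mul_comm ((-1) ^ (n + 1)), mul_assoc]
      exact dvd_mul_right _ _
  obtain ⟨k, hk⟩ := even_natDegree_of_comp_one_sub_X hcomp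
  omega

theorem stmt17 (n j : ℕ) (hj : j ≤ 2 * n) :
    ∃ b : Polynomial ℚ,
      (b.natDegree ≤ 2 * n ∧ (X - 1) ^ (n + 1) ∣ b - (X - 1) ^ j ∧
          X ^ (n + 1) ∣ b - (-X) ^ j ∧ ∀ i, (b.coeff i).den = 1) ∧
      ∀ b' : Polynomial ℚ,
        (b'.natDegree ≤ 2 * n ∧ (X - 1) ^ (n + 1) ∣ b' - (X - 1) ^ j ∧
            X ^ (n + 1) ∣ b' - (-X) ^ j) → b' = b := by
  obtain ⟨p, hp, h₁, h₂⟩ := exists_int_natDegree_le_dvd_sub n j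
  have hp' : (p.map (Int.castRingHom ℚ)).natDegree ≤ 2 * n := natDegree_map_le.trans hp
  have h₁' := map_dvd (mapRingHom (Int.castRingHom ℚ)) h₁
  have h₂' := map_dvd (mapRingHom (Int.castRingHom ℚ)) h₂
  simp only [map_sub, map_pow, map_neg, map_one, coe_mapRingHom, map_X] at h₁' h₂'
  refine ⟨p.map (Int.castRingHom ℚ), ⟨hp', h₁', h₂', fun i => by simp⟩, ?_⟩
  rintro b' ⟨hb, hb₁, hb₂⟩
  exact eq_of_dvd_sub_of_natDegree_lt (m := n + 1) (by omega) (by omega) hb₁ hb₂ h₁' h₂'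
end

section
/- Let n ≥ 0 and k be integers, and let c_0, c_1, ..., c_{2n+2} be rational numbers. For 0 ≤ j ≤ 2n+2 define b_j := (k−1)^j + c_j + (−1)^{j+1} Σ_{i=0}^{j} binom(j, i)·c_i. If b_j = 0 for every j with n+1 ≤ j ≤ 2n, then (n+1)·b_{2n+1} + b_{2n+2} = k^{n+1}·(k−1)^{n+1}. -/
open Polynomial in
/-- The transform `b` of the sequence `c`, evaluated umbrally: `c i = L (X ^ i)`. -/
theorem umbral_transform_eq (x : ℚ) (c : ℕ → ℚ) (L : ℚ[X] →ₗ[ℚ] ℚ)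
    (hL : ∀ i, L (X ^ i) = c i) (j : ℕ) :
    x ^ j + c j + (-1 : ℚ) ^ (j + 1) * ∑ i ∈ Finset.range (j + 1), (j.choose i : ℚ) * c i =
      x ^ j + L (X ^ j) - L ((-1 - X) ^ j) := by
  have h : (-1 - X : ℚ[X]) ^ j =
      (-1 : ℚ) ^ j • ∑ i ∈ Finset.range (j + 1), (j.choose i : ℚ) • X ^ i := by
    rw [show (-1 - X : ℚ[X]) = C (-1) * (X + 1) by simp; ring, mul_pow, add_pow,
      smul_eq_C_mul, C_pow]
    congr 1
    refine Finset.sum_congr rfl fun i _ => ?_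
    rw [smul_eq_C_mul, one_pow, mul_one, mul_comm, map_natCast]
  rw [h, map_smul, map_sum]
  simp only [map_smul, hL, smul_eq_mul]
  ring

open Polynomial in
/-- The polynomial `X ^ m * (X + 1) ^ m` is invariant under `X ↦ -1 - X`, so the binomial
combination of the transformed sequence does not depend on `c`. -/
theorem sum_choose_mul_umbral_transform (x : ℚ) (c b : ℕ → ℚ)
    (hb : ∀ j, b j = x ^ j + c j +
      (-1 : ℚ) ^ (j + 1) * ∑ i ∈ Finset.range (j + 1), (j.choose i : ℚ) * c i) (m : ℕ) :
    ∑ i ∈ Finset.range (m + 1), (m.choose i : ℚ) * b (m + i) = (x + 1) ^ m * x ^ m := by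
  let L : ℚ[X] →ₗ[ℚ] ℚ := (basisMonomials ℚ).constr ℚ c
  have hL (i : ℕ) : L (X ^ i) = c i := by
    rw [X_pow_eq_monomial]
    simpa using (basisMonomials ℚ).constr_basis ℚ c i
  have expand {R : Type} [CommRing R] [Algebra ℚ R] (y : R) :
      ∑ i ∈ Finset.range (m + 1), (m.choose i : ℚ) • y ^ (m + i) = (y + 1) ^ m * y ^ m := by
    rw [add_pow, Finset.sum_mul]
    refine Finset.sum_congr rfl fun i _ => ?_
    rw [Algebra.smul_def, map_natCast, one_pow, pow_add]
    ring
  have symm : L ((X + 1) ^ m * X ^ m) = L ((-1 - X + 1) ^ m * (-1 - X) ^ m) := by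
    congr 1
    rw [← mul_pow, ← mul_pow]
    congr 1
    ring
  rw [← expand, ← expand, map_sum, map_sum] at symm
  rw [← expand x]
  simp only [map_smul, smul_eq_mul] at symm ⊢
  simp only [hb, umbral_transform_eq x c L hL, mul_sub, mul_add, Finset.sum_sub_distrib,
    Finset.sum_add_distrib, symm, add_sub_cancel_right]

theorem stmt18 (n : ℕ) (k : ℤ) (c : ℕ → ℚ) (b : ℕ → ℚ)
    (hb : ∀ j, b j = ((k : ℚ) - 1) ^ j + c j +
      (-1 : ℚ) ^ (j + 1) * ∑ i ∈ Finset.range (j + 1), (j.choose i : ℚ) * c i)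
    (hzero : ∀ j, n + 1 ≤ j → j ≤ 2 * n → b j = 0) :
    ((n : ℚ) + 1) * b (2 * n + 1) + b (2 * n + 2) =
      (k : ℚ) ^ (n + 1) * ((k : ℚ) - 1) ^ (n + 1) := by
  have h := sum_choose_mul_umbral_transform _ c b hb (n + 1)
  rw [Finset.sum_range_succ, Finset.sum_range_succ, Finset.sum_eq_zero, zero_add,
    Nat.choose_self, Nat.choose_succ_self_right, sub_add_cancel] at h
  · rw [← h, show n + 1 + n = 2 * n + 1 by ring, show n + 1 + (n + 1) = 2 * n + 2 by ring]
    push_cast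
    ring
  · intro i hi
    have := Finset.mem_range.mp hi
    rw [hzero _ (by lia) (by lia), mul_zero]
end

section
/- Let m and n be non-negative integers with m ≤ 2n, and let f = Σ_{j=0}^{m} a_j T^j ∈ ℚ[T] be a polynomial of degree at most m satisfying f(T) = f(−1−T) (equality of polynomials after substituting T ↦ −1−T). For each 0 ≤ j ≤ 2n let b_{j,n}(T) be the unique polynomial in ℚ[T] of degree at most 2n such that (T−1)^{n+1} divides b_{j,n}(T) − (T−1)^j and T^{n+1} divides b_{j,n}(T) − (−1)^j T^j. Then Σ_{j=0}^{m} a_j · b_{j,n}(T) = f(T−1), i.e. the composite of f with the substitution T ↦ T−1. -/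
open Polynomial

theorem stmt19 (m n : ℕ) (hmn : m ≤ 2 * n) (f : Polynomial ℚ)
    (hfdeg : f.natDegree ≤ m) (hf : f.comp (-1 - X) = f)
    (b : ℕ → Polynomial ℚ)
    (hbdeg : ∀ j ≤ 2 * n, (b j).natDegree ≤ 2 * n)
    (hb1 : ∀ j ≤ 2 * n, (X - 1) ^ (n + 1) ∣ b j - (X - 1) ^ j)
    (hb2 : ∀ j ≤ 2 * n, X ^ (n + 1) ∣ b j - (-1) ^ j * X ^ j) :
    ∑ j ∈ Finset.range (m + 1), C (f.coeff j) * b j = f.comp (X - 1) := by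
  have hexp : ∀ q : ℚ[X], f.comp q = ∑ j ∈ Finset.range (m + 1), C (f.coeff j) * q ^ j :=
    fun q => eval₂_eq_sum_range' C (Nat.lt_succ_of_le hfdeg) q
  have hneg : f.comp (X - 1) = f.comp (-X) := by
    conv_lhs => rw [← hf]
    rw [comp_assoc]
    congr 1
    simp only [sub_comp, neg_comp, one_comp, X_comp]
    ring
  have hle : ∀ j ∈ Finset.range (m + 1), j ≤ 2 * n := fun j hj => by
    have := Finset.mem_range.mp hj
    omega
  rw [← sub_eq_zero]
  set D := ∑ j ∈ Finset.range (m + 1), C (f.coeff j) * b j - f.comp (X - 1) with hD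
  have h1 : (X - 1) ^ (n + 1) ∣ D := by
    rw [hD, hexp, ← Finset.sum_sub_distrib]
    refine Finset.dvd_sum fun j hj => ?_
    rw [← mul_sub]
    exact (hb1 j (hle j hj)).mul_left _
  have h2 : X ^ (n + 1) ∣ D := by
    rw [hD, hneg, hexp, ← Finset.sum_sub_distrib]
    refine Finset.dvd_sum fun j hj => ?_
    rw [← mul_sub, neg_pow]
    exact (hb2 j (hle j hj)).mul_left _
  have hcop : IsCoprime ((X - 1 : ℚ[X]) ^ (n + 1)) (X ^ (n + 1)) :=
    IsCoprime.pow ⟨-1, 1, by ring⟩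
  have hmonic : (X - 1 : ℚ[X]).Monic := monic_X_sub_C 1
  have hdegX : (X - 1 : ℚ[X]).natDegree = 1 := natDegree_X_sub_C 1
  have hDdeg : D.natDegree ≤ 2 * n := by
    refine (natDegree_sub_le _ _).trans (max_le ?_ ?_)
    · exact natDegree_sum_le_of_forall_le _ _ fun j hj =>
        (natDegree_C_mul_le _ _).trans (hbdeg j (hle j hj))
    · rw [natDegree_comp, hdegX]
      omega
  refine eq_zero_of_dvd_of_natDegree_lt (hcop.mul_dvd h1 h2) ?_
  rw [(hmonic.pow _).natDegree_mul (monic_X.pow _), hmonic.natDegree_pow, hdegX,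
    natDegree_X_pow]
  omega
end
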